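/- Let K, P : ℕ → ℕ be sequences with K_n ≤ P_n. If n³·τ(K_n,P_n) → 0, where τ(K,P) = K³/P² + (K²/P)³, then the probability that the random key graph K(n; K_n, P_n) contains at least one triangle tends to 0 as n → ∞. -/

import Mathlib

open Finset Filter

/-- Sample space of the random key graph: assignments of a `K`-subset of the key pool
`Fin P` to each of the `n` nodes (all equally likely). -/
def keySpace (n K P : ℕ) : Finset (Fin n → Finset (Fin P)) :=
  Fintype.piFinset (fun _ => Finset.univ.powersetCard K)

/-- The key assignment `f` contains a triangle: three distinct nodes with pairwise
intersecting key rings. -/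
def hasTriangle (n P : ℕ) (f : Fin n → Finset (Fin P)) : Prop :=
  ∃ i j k : Fin n, i ≠ j ∧ i ≠ k ∧ j ≠ k ∧
    (f i ∩ f j).Nonempty ∧ (f i ∩ f k).Nonempty ∧ (f j ∩ f k).Nonempty

instance (n P : ℕ) (f : Fin n → Finset (Fin P)) : Decidable (hasTriangle n P f) := by
  unfold hasTriangle; infer_instance

/-- `τ(K,P) = K³/P² + (K²/P)³`. -/
noncomputable def tauKP (K P : ℕ) : ℝ :=
  (K : ℝ) ^ 3 / (P : ℝ) ^ 2 + ((K : ℝ) ^ 2 / (P : ℝ)) ^ 3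

lemma kg_one {K P : ℕ} (x : Fin P) (hK : 0 < K) :
    ((((univ : Finset (Fin P)).powersetCard K).filter (fun A => x ∈ A)).card : ℝ) ≤
      (K / P : ℝ) * (P.choose K : ℝ) := by
  obtain ⟨p, rfl⟩ : ∃ p, P = p + 1 := ⟨P - 1, by have := x.2; omega⟩
  obtain ⟨k, rfl⟩ : ∃ k, K = k + 1 := ⟨K - 1, by omega⟩
  have h1 : (((univ : Finset (Fin (p+1))).powersetCard (k+1)).filter (fun A => x ∈ A)).card
      ≤ p.choose k := by
    have hs : ((univ : Finset (Fin (p+1))).powersetCard (k+1)).filter (fun A => x ∈ A) ⊆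
        ((univ.erase x).powersetCard k).image (fun A => insert x A) := by
      intro A hA
      simp only [mem_filter, mem_powersetCard, mem_image] at hA ⊢
      refine ⟨A.erase x, ⟨erase_subset_erase _ (subset_univ _), ?_⟩, insert_erase hA.2⟩
      rw [card_erase_of_mem hA.2, hA.1.2]; rfl
    refine (card_le_card hs).trans (card_image_le.trans ?_)
    rw [card_powersetCard, card_erase_of_mem (mem_univ _)]; simp
  have h2 : ((p + 1 : ℕ) : ℝ) * p.choose k = (p+1).choose (k+1) * ((k + 1 : ℕ) : ℝ) := by
    exact_mod_cast Nat.add_one_mul_choose_eq p k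
  have hp : (0:ℝ) < ((p + 1 : ℕ) : ℝ) := by positivity
  rw [div_mul_eq_mul_div, le_div_iff₀ hp]
  have h3 : ((((univ : Finset (Fin (p+1))).powersetCard (k+1)).filter
    (fun A => x ∈ A)).card : ℝ) ≤ p.choose k := by exact_mod_cast h1
  nlinarith

lemma kg_two {K P : ℕ} (x y : Fin P) (hxy : x ≠ y) (hKP : K ≤ P) :
    ((((univ : Finset (Fin P)).powersetCard K).filter (fun A => x ∈ A ∧ y ∈ A)).card : ℝ) ≤
      (K / P : ℝ) ^ 2 * (P.choose K : ℝ) := by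
  by_cases hK : K < 2
  · have : ((univ : Finset (Fin P)).powersetCard K).filter (fun A => x ∈ A ∧ y ∈ A) = ∅ := by
      refine filter_eq_empty_iff.2 fun A hA h => ?_
      rw [mem_powersetCard] at hA
      have : 1 < A.card := one_lt_card.2 ⟨x, h.1, y, h.2, hxy⟩
      omega
    rw [this]; simp; positivity
  obtain ⟨k, rfl⟩ : ∃ k, K = k + 2 := ⟨K - 2, by omega⟩
  obtain ⟨p, rfl⟩ : ∃ p, P = p + 2 := ⟨P - 2, by omega⟩
  have h1 : (((univ : Finset (Fin (p+2))).powersetCard (k+2)).filter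
      (fun A => x ∈ A ∧ y ∈ A)).card ≤ p.choose k := by
    have hs : ((univ : Finset (Fin (p+2))).powersetCard (k+2)).filter
        (fun A => x ∈ A ∧ y ∈ A) ⊆
        (((univ.erase x).erase y).powersetCard k).image (fun A => insert x (insert y A)) := by
      intro A hA
      simp only [mem_filter, mem_powersetCard, mem_image] at hA ⊢
      have hy : y ∈ A.erase x := mem_erase.2 ⟨hxy.symm, hA.2.2⟩
      refine ⟨(A.erase x).erase y, ⟨erase_subset_erase _ (erase_subset_erase _ (subset_univ _)),
        ?_⟩, ?_⟩
      · rw [card_erase_of_mem hy, card_erase_of_mem hA.2.1, hA.1.2]; rfl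
      · rw [insert_erase hy, insert_erase hA.2.1]
    refine (card_le_card hs).trans (card_image_le.trans ?_)
    rw [card_powersetCard, card_erase_of_mem (mem_erase.2 ⟨hxy.symm, mem_univ _⟩),
      card_erase_of_mem (mem_univ _)]; simp
  have h2 : ((p : ℝ) + 1) * p.choose k = (p+1).choose (k+1) * ((k : ℝ) + 1) := by
    exact_mod_cast Nat.add_one_mul_choose_eq p k
  have h2' : ((p : ℝ) + 2) * (p+1).choose (k+1) = (p+2).choose (k+2) * ((k : ℝ) + 2) := by
    exact_mod_cast Nat.add_one_mul_choose_eq (p+1) (k+1)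
  have h3 : ((((univ : Finset (Fin (p+2))).powersetCard (k+2)).filter
    (fun A => x ∈ A ∧ y ∈ A)).card : ℝ) ≤ p.choose k := by exact_mod_cast h1
  refine h3.trans ?_
  have hkp : (k : ℝ) ≤ p := by exact_mod_cast (by omega : k ≤ p)
  have e1 : (p.choose k : ℝ) = ((k : ℝ) + 1) / (p + 1) * (((k : ℝ) + 2) / (p + 2)) *
      (p+2).choose (k+2) := by
    field_simp
    linear_combination ((p:ℝ) + 2) * h2 + ((k:ℝ)+1) * h2'
  rw [e1]
  push_cast
  have e2 : ((k : ℝ) + 1) / (p + 1) ≤ ((k : ℝ) + 2) / (p + 2) := by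
    rw [div_le_div_iff₀ (by positivity) (by positivity)]; nlinarith
  rw [sq]
  gcongr

lemma kg_prod {n K P : ℕ} (i j k : Fin n) (hij : i ≠ j) (hik : i ≠ k) (hjk : j ≠ k)
    (Q R T : Finset (Fin P) → Prop) [DecidablePred Q] [DecidablePred R] [DecidablePred T]
    (q r t : ℝ)
    (hQ : ((((univ : Finset (Fin P)).powersetCard K).filter Q).card : ℝ) ≤ q * P.choose K)
    (hR : ((((univ : Finset (Fin P)).powersetCard K).filter R).card : ℝ) ≤ r * P.choose K)
    (hT : ((((univ : Finset (Fin P)).powersetCard K).filter T).card : ℝ) ≤ t * P.choose K) :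
    (((keySpace n K P).filter (fun f => Q (f i) ∧ R (f j) ∧ T (f k))).card : ℝ) ≤
      q * r * t * (keySpace n K P).card := by
  let S := (univ : Finset (Fin P)).powersetCard K
  let g : Fin n → Finset (Finset (Fin P)) := fun l =>
    if l = i then S.filter Q else if l = j then S.filter R else if l = k then S.filter T else S
  have hsub : (keySpace n K P).filter (fun f => Q (f i) ∧ R (f j) ∧ T (f k)) ⊆
      Fintype.piFinset g := by
    intro f hf
    simp only [keySpace, mem_filter, Fintype.mem_piFinset] at hf ⊢
    intro l
    have := hf.1 l
    simp only [g]
    split_ifs with h1 h2 h3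
    · subst h1; exact mem_filter.2 ⟨this, hf.2.1⟩
    · subst h2; exact mem_filter.2 ⟨this, hf.2.2.1⟩
    · subst h3; exact mem_filter.2 ⟨this, hf.2.2.2⟩
    · exact this
  have h1 : (((keySpace n K P).filter (fun f => Q (f i) ∧ R (f j) ∧ T (f k))).card : ℝ) ≤
      ∏ l, ((g l).card : ℝ) := by
    have := card_le_card hsub
    rw [Fintype.card_piFinset] at this
    exact_mod_cast this
  refine h1.trans ?_
  have h2 : ∏ l, ((g l).card : ℝ) ≤ ∏ l, (((if l = i then q else 1) * (if l = j then r else 1) *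
      (if l = k then t else 1)) * (P.choose K : ℝ)) := by
    refine prod_le_prod (fun _ _ => by positivity) fun l _ => ?_
    simp only [g]
    split_ifs with h1 h2 h3 h4 h5 h6 <;> first | (exfalso; grind) | skip
    all_goals first | simpa using hQ | simpa using hR | simpa using hT | simp [S]
  refine h2.trans (le_of_eq ?_)
  rw [prod_mul_distrib, prod_mul_distrib, prod_mul_distrib]
  simp [keySpace, Fintype.card_piFinset]

lemma kg_bound {n K P : ℕ} (hK : 0 < K) (hKP : K ≤ P) :
    (((keySpace n K P).filter (fun f => hasTriangle n P f)).card : ℝ) ≤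
      (n : ℝ) ^ 3 * tauKP K P * (keySpace n K P).card := by
  classical
  have hP : (0 : ℝ) < P := by exact_mod_cast hK.trans_le hKP
  let I : Finset (Fin n × Fin n × Fin n) :=
    univ.filter (fun w => w.1 ≠ w.2.1 ∧ w.1 ≠ w.2.2 ∧ w.2.1 ≠ w.2.2)
  let J : Finset (Fin P × Fin P × Fin P) :=
    univ.filter (fun w => w.1 ≠ w.2.1 ∧ w.1 ≠ w.2.2 ∧ w.2.1 ≠ w.2.2)
  let E1 : (Fin n × Fin n × Fin n) → Fin P → Finset (Fin n → Finset (Fin P)) := fun w x =>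
    (keySpace n K P).filter (fun f => x ∈ f w.1 ∧ x ∈ f w.2.1 ∧ x ∈ f w.2.2)
  let E2 : (Fin n × Fin n × Fin n) → (Fin P × Fin P × Fin P) →
      Finset (Fin n → Finset (Fin P)) := fun w x =>
    (keySpace n K P).filter (fun f => (x.1 ∈ f w.1 ∧ x.2.1 ∈ f w.1) ∧
      (x.1 ∈ f w.2.1 ∧ x.2.2 ∈ f w.2.1) ∧ (x.2.1 ∈ f w.2.2 ∧ x.2.2 ∈ f w.2.2))
  have hsub : (keySpace n K P).filter (fun f => hasTriangle n P f) ⊆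
      I.biUnion (fun w => univ.biUnion (E1 w) ∪ J.biUnion (E2 w)) := by
    intro f hf
    obtain ⟨hf0, i, j, k, hij, hik, hjk, ⟨x, hx⟩, ⟨y, hy⟩, ⟨z, hz⟩⟩ := mem_filter.1 hf
    rw [mem_inter] at hx hy hz
    refine mem_biUnion.2 ⟨(i, j, k), by simp [I, hij, hik, hjk], ?_⟩
    rw [mem_union, mem_biUnion, mem_biUnion]
    by_cases hxy : x = y
    · subst hxy; exact Or.inl ⟨x, mem_univ _, mem_filter.2 ⟨hf0, hx.1, hx.2, hy.2⟩⟩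
    by_cases hxz : x = z
    · subst hxz; exact Or.inl ⟨x, mem_univ _, mem_filter.2 ⟨hf0, hx.1, hx.2, hz.2⟩⟩
    by_cases hyz : y = z
    · subst hyz; exact Or.inl ⟨y, mem_univ _, mem_filter.2 ⟨hf0, hy.1, hz.1, hy.2⟩⟩
    exact Or.inr ⟨(x, y, z), by simp [J, hxy, hxz, hyz],
      mem_filter.2 ⟨hf0, ⟨hx.1, hy.1⟩, ⟨hx.2, hz.1⟩, ⟨hy.2, hz.2⟩⟩⟩
  set N : ℝ := ((keySpace n K P).card : ℝ) with hN
  have hN0 : 0 ≤ N := by positivity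
  have hI : (I.card : ℝ) ≤ (n : ℝ) ^ 3 := by
    have : I.card ≤ n ^ 3 := (card_le_univ I).trans (by simp; ring_nf; rfl)
    exact_mod_cast this
  have hJ : (J.card : ℝ) ≤ (P : ℝ) ^ 3 := by
    have : J.card ≤ P ^ 3 := (card_le_univ J).trans (by simp; ring_nf; rfl)
    exact_mod_cast this
  have hE1 : ∀ w ∈ I, ∀ x, ((E1 w x).card : ℝ) ≤ (K / P : ℝ) ^ 3 * N := by
    intro w hw x
    obtain ⟨-, h1, h2, h3⟩ := mem_filter.1 hw
    have := kg_prod w.1 w.2.1 w.2.2 h1 h2 h3 (fun A => x ∈ A) (fun A => x ∈ A) (fun A => x ∈ A)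
      _ _ _ (kg_one x hK) (kg_one x hK) (kg_one x hK)
    refine this.trans (le_of_eq ?_)
    rw [hN]; ring
  have hE2 : ∀ w ∈ I, ∀ x ∈ J, ((E2 w x).card : ℝ) ≤ (K / P : ℝ) ^ 6 * N := by
    intro w hw x hx
    obtain ⟨-, h1, h2, h3⟩ := mem_filter.1 hw
    obtain ⟨-, g1, g2, g3⟩ := mem_filter.1 hx
    have := kg_prod w.1 w.2.1 w.2.2 h1 h2 h3 (fun A => x.1 ∈ A ∧ x.2.1 ∈ A)
      (fun A => x.1 ∈ A ∧ x.2.2 ∈ A) (fun A => x.2.1 ∈ A ∧ x.2.2 ∈ A)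
      _ _ _ (kg_two _ _ g1 hKP) (kg_two _ _ g2 hKP) (kg_two _ _ g3 hKP)
    refine this.trans (le_of_eq ?_)
    rw [hN]; ring
  have hw : ∀ w ∈ I, ((univ.biUnion (E1 w) ∪ J.biUnion (E2 w)).card : ℝ) ≤ tauKP K P * N := by
    intro w hw
    have a1 : ((univ.biUnion (E1 w)).card : ℝ) ≤ P * ((K / P : ℝ) ^ 3 * N) := by
      calc ((univ.biUnion (E1 w)).card : ℝ) ≤ ∑ x, ((E1 w x).card : ℝ) := by
            exact_mod_cast card_biUnion_le
        _ ≤ ∑ x : Fin P, ((K / P : ℝ) ^ 3 * N) := sum_le_sum fun x _ => hE1 w hw x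
        _ = _ := by simp
    have a2 : ((J.biUnion (E2 w)).card : ℝ) ≤ P ^ 3 * ((K / P : ℝ) ^ 6 * N) := by
      calc ((J.biUnion (E2 w)).card : ℝ) ≤ ∑ x ∈ J, ((E2 w x).card : ℝ) := by
            exact_mod_cast card_biUnion_le
        _ ≤ ∑ x ∈ J, ((K / P : ℝ) ^ 6 * N) := sum_le_sum fun x hx => hE2 w hw x hx
        _ = J.card * ((K / P : ℝ) ^ 6 * N) := by simp
        _ ≤ _ := by gcongr
    have a3 : ((univ.biUnion (E1 w) ∪ J.biUnion (E2 w)).card : ℝ) ≤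
        (univ.biUnion (E1 w)).card + (J.biUnion (E2 w)).card := by
      exact_mod_cast card_union_le _ _
    refine a3.trans ((add_le_add a1 a2).trans (le_of_eq ?_))
    unfold tauKP
    field_simp
  have ht : 0 ≤ tauKP K P := by unfold tauKP; positivity
  calc (((keySpace n K P).filter (fun f => hasTriangle n P f)).card : ℝ)
      ≤ ((I.biUnion (fun w => univ.biUnion (E1 w) ∪ J.biUnion (E2 w))).card : ℝ) := by
        exact_mod_cast card_le_card hsub
    _ ≤ ∑ w ∈ I, ((univ.biUnion (E1 w) ∪ J.biUnion (E2 w)).card : ℝ) := by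
        exact_mod_cast card_biUnion_le
    _ ≤ ∑ w ∈ I, (tauKP K P * N) := sum_le_sum hw
    _ = I.card * (tauKP K P * N) := by simp
    _ ≤ (n : ℝ) ^ 3 * (tauKP K P * N) := by gcongr
    _ = _ := by ring

theorem zero_law_for_triangles (K P : ℕ → ℕ)
    (hK : ∀ n, 0 < K n) (hKP : ∀ n, K n ≤ P n)
    (hcond : Tendsto (fun n : ℕ => (n : ℝ) ^ 3 * tauKP (K n) (P n)) atTop (nhds 0)) :
    Tendsto (fun n : ℕ =>
        (((keySpace n (K n) (P n)).filter (fun f => hasTriangle n (P n) f)).card : ℝ) /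
          ((keySpace n (K n) (P n)).card : ℝ))
      atTop (nhds 0) := by
  refine squeeze_zero (fun n => by positivity) (fun n => ?_) hcond
  have ht : 0 ≤ tauKP (K n) (P n) := by unfold tauKP; positivity
  exact div_le_of_le_mul₀ (by positivity) (by positivity) (kg_bound (hK n) (hKP n))
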